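/- (Andrews' analytic form of the Rogers–Ramanujan–Gordon identity.) Let k ≥ 2 and a be integers with 1 ≤ a ≤ k. As formal power series in q (equivalently, for |q| < 1), Σ_{n_1,…,n_{k−1} ≥ 0} q^{N_1² + N_2² + ⋯ + N_{k−1}² + N_a + N_{a+1} + ⋯ + N_{k−1}} / ((q; q)_{n_1} (q; q)_{n_2} ⋯ (q; q)_{n_{k−1}}) = (q^{2k+1}; q^{2k+1})_∞ (q^a; q^{2k+1})_∞ (q^{2k+1−a}; q^{2k+1})_∞ / (q; q)_∞, where N_j = n_j + n_{j+1} + ⋯ + n_{k−1}. -/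

import Mathlib

open scoped BigOperators

/-- The infinite q-Pochhammer symbol `(z; q)_∞ = ∏_{j ≥ 0} (1 - z qʲ)`. -/
noncomputable def pochInf (z q : ℂ) : ℂ := ∏' j : ℕ, (1 - z * q ^ j)

/-- The finite q-Pochhammer symbol `(z; q)_n = (1 - z)(1 - zq)⋯(1 - z q^{n-1})`. -/
noncomputable def pochFin (z q : ℂ) (n : ℕ) : ℂ := ∏ t ∈ Finset.range n, (1 - z * q ^ t)

/-- Given `f : Fin (k-1) → ℕ` encoding `n_1, …, n_{k-1}` (so `f i` is `n_{i+1}`),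
`partialSumN k f j` is `N_j = n_j + n_{j+1} + ⋯ + n_{k-1}` for `1 ≤ j ≤ k-1`. -/
def partialSumN (k : ℕ) (f : Fin (k - 1) → ℕ) (j : ℕ) : ℕ :=
  ∑ i : Fin (k - 1), if j ≤ i.1 + 1 then f i else 0

open Filter Topology Finset

/-! ### Reciprocals of q-Pochhammer symbols -/

/-- The reciprocal `1 / (q; q)_n`. -/
noncomputable def invPoch (q : ℂ) (n : ℕ) : ℂ := (pochFin q q n)⁻¹

lemma one_sub_pow_succ_ne_zero {q : ℂ} (hq : ‖q‖ < 1) (n : ℕ) : 1 - q ^ (n + 1) ≠ 0 := by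
  intro h
  have h1 : ‖q ^ (n + 1)‖ = 1 := by rw [← sub_eq_zero.mp h, norm_one]
  rw [norm_pow] at h1
  exact (pow_lt_one₀ (norm_nonneg q) hq (Nat.succ_ne_zero n)).ne h1

lemma pochFin_succ (z q : ℂ) (n : ℕ) :
    pochFin z q (n + 1) = pochFin z q n * (1 - z * q ^ n) := prod_range_succ _ _

lemma invPoch_zero (q : ℂ) : invPoch q 0 = 1 := by simp [invPoch, pochFin]

lemma invPoch_eq {q : ℂ} (hq : ‖q‖ < 1) (n : ℕ) :
    invPoch q n = (1 - q ^ (n + 1)) * invPoch q (n + 1) := by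
  have h := one_sub_pow_succ_ne_zero hq n
  rw [invPoch, invPoch, pochFin_succ, ← pow_succ', mul_inv, mul_left_comm, mul_inv_cancel₀ h,
    mul_one]

lemma summable_mul_pow (z : ℂ) {q : ℂ} (hq : ‖q‖ < 1) :
    Summable fun j : ℕ ↦ ‖-(z * q ^ j)‖ := by
  simpa [norm_mul, norm_pow] using
    (summable_geometric_of_lt_one (norm_nonneg q) hq).mul_left ‖z‖

lemma tendsto_pochFin (z : ℂ) {q : ℂ} (hq : ‖q‖ < 1) :
    Tendsto (pochFin z q) atTop (𝓝 (pochInf z q)) := by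
  have h := (multipliable_one_add_of_summable (summable_mul_pow z hq)).hasProd.tendsto_prod_nat
  simp only [← sub_eq_add_neg] at h
  exact h

lemma pochInf_self_ne_zero {q : ℂ} (hq : ‖q‖ < 1) : pochInf q q ≠ 0 := by
  have h := tprod_one_add_ne_zero_of_summable (f := fun j : ℕ ↦ -(q * q ^ j)) (fun j ↦ by
    rw [← sub_eq_add_neg, ← pow_succ']
    exact one_sub_pow_succ_ne_zero hq j) (summable_mul_pow q hq)
  simp only [← sub_eq_add_neg] at h
  exact h

lemma tendsto_invPoch {q : ℂ} (hq : ‖q‖ < 1) :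
    Tendsto (invPoch q) atTop (𝓝 (pochInf q q)⁻¹) :=
  (tendsto_pochFin q hq).inv₀ (pochInf_self_ne_zero hq)

lemma exists_norm_invPoch_le {q : ℂ} (hq : ‖q‖ < 1) : ∃ C, ∀ n, ‖invPoch q n‖ ≤ C := by
  obtain ⟨C, hC⟩ := (tendsto_invPoch hq).norm.bddAbove_range
  exact ⟨C, fun n ↦ hC ⟨n, rfl⟩⟩

/-- The q-Vandermonde sum. -/
lemma sum_invPoch_mul {q : ℂ} (hq : ‖q‖ < 1) (n c : ℕ) :
    ∑ t ∈ range (n + 1), q ^ (t ^ 2 + c * t) *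
        (invPoch q (n - t) * invPoch q t * invPoch q (t + c)) =
      invPoch q n * invPoch q (n + c) := by
  induction n generalizing c with
  | zero => simp [invPoch_zero]
  | succ n ih =>
    have h0 := one_sub_pow_succ_ne_zero hq n
    apply mul_left_cancel₀ h0
    have hsplit : (1 - q ^ (n + 1)) * ∑ t ∈ range (n + 1 + 1), q ^ (t ^ 2 + c * t) *
          (invPoch q (n + 1 - t) * invPoch q t * invPoch q (t + c)) =
        ∑ t ∈ range (n + 1 + 1), (1 - q ^ (n + 1 - t)) * (q ^ (t ^ 2 + c * t) *
          (invPoch q (n + 1 - t) * invPoch q t * invPoch q (t + c))) +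
        ∑ t ∈ range (n + 1 + 1), q ^ (n + 1 - t) * (1 - q ^ t) * (q ^ (t ^ 2 + c * t) *
          (invPoch q (n + 1 - t) * invPoch q t * invPoch q (t + c))) := by
      rw [mul_sum, ← sum_add_distrib]
      refine sum_congr rfl fun t ht ↦ ?_
      have : q ^ (n + 1) = q ^ (n + 1 - t) * q ^ t := by
        rw [← pow_add, Nat.sub_add_cancel (by simpa using mem_range_succ_iff.mp ht)]
      rw [this]; ring
    have h1 : ∑ t ∈ range (n + 1 + 1), (1 - q ^ (n + 1 - t)) * (q ^ (t ^ 2 + c * t) *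
          (invPoch q (n + 1 - t) * invPoch q t * invPoch q (t + c))) =
        invPoch q n * invPoch q (n + c) := by
      rw [sum_range_succ, ← ih c]
      simp only [Nat.sub_self, pow_zero, sub_self, zero_mul, add_zero]
      refine sum_congr rfl fun t ht ↦ ?_
      have e : n + 1 - t = n - t + 1 := by have := mem_range_succ_iff.mp ht; omega
      rw [e, invPoch_eq hq (n - t)]; ring
    have h2 : ∑ t ∈ range (n + 1 + 1), q ^ (n + 1 - t) * (1 - q ^ t) * (q ^ (t ^ 2 + c * t) *
          (invPoch q (n + 1 - t) * invPoch q t * invPoch q (t + c))) =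
        q ^ (n + 1 + c) * (invPoch q n * invPoch q (n + (c + 1))) := by
      rw [sum_range_succ', ← ih (c + 1), mul_sum]
      simp only [pow_zero, sub_self, zero_mul, mul_zero, add_zero]
      refine sum_congr rfl fun t ht ↦ ?_
      obtain ⟨d, rfl⟩ := Nat.exists_eq_add_of_le (mem_range_succ_iff.mp ht)
      have e : t + d + 1 - (t + 1) = d := by omega
      have e' : t + d - t = d := by omega
      rw [e, e', invPoch_eq hq t, show t + 1 + c = t + (c + 1) by ring]
      ring
    rw [hsplit, h1, h2, invPoch_eq hq (n + c), invPoch_eq hq n,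
      show n + (c + 1) = n + c + 1 by ring, show n + 1 + c = n + c + 1 by ring]
    ring

/-! ### Bailey pairs -/

/-- The pair `(γ, β)` is a Bailey pair relative to `q ^ e`, in the normalization
`β_N = ∑_{i ≤ N} γ_i / ((q; q)_{N-i} (q; q)_{N+i+e})`. -/
def IsBaileyPair (q : ℂ) (e : ℕ) (γ β : ℕ → ℂ) : Prop :=
  ∀ N, β N = ∑ i ∈ range (N + 1), γ i * (invPoch q (N - i) * invPoch q (N + i + e))

/-- The transformation of the sequence `β` in Bailey's lemma relative to `q ^ e`. -/
noncomputable def baileyStep (q : ℂ) (e : ℕ) (β : ℕ → ℂ) (N : ℕ) : ℂ :=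
  ∑ s ∈ range (N + 1), q ^ (s ^ 2 + e * s) * invPoch q (N - s) * β s

/-- Bailey's lemma. -/
lemma IsBaileyPair.step {q : ℂ} (hq : ‖q‖ < 1) {e : ℕ} {γ β : ℕ → ℂ}
    (h : IsBaileyPair q e γ β) :
    IsBaileyPair q e (fun i ↦ q ^ (i ^ 2 + e * i) * γ i) (baileyStep q e β) := by
  intro N
  simp only [baileyStep, h _, mul_sum]
  rw [sum_comm' (s' := fun i ↦ Ico i (N + 1)) (t' := range (N + 1)) (by grind)]
  refine sum_congr rfl fun i hi ↦ ?_
  obtain ⟨n, rfl⟩ := Nat.exists_eq_add_of_le (mem_range_succ_iff.mp hi)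
  have e1 : i + n - i = n := by omega
  have e2 : i + n + 1 - i = n + 1 := by omega
  rw [sum_Ico_eq_sum_range, e1, e2, show i + n + i + e = n + (2 * i + e) by ring,
    ← sum_invPoch_mul hq n (2 * i + e), mul_sum]
  refine sum_congr rfl fun t _ ↦ ?_
  have e3 : i + n - (i + t) = n - t := by omega
  have e4 : i + t - i = t := by omega
  rw [e3, e4, show i + t + i + e = t + (2 * i + e) by ring]
  ring

/-- The unit Bailey pair relative to `q`. -/
lemma isBaileyPair_unit {q : ℂ} (hq : ‖q‖ < 1) :
    IsBaileyPair q 1 (fun i ↦ (-1) ^ i * q ^ (i.choose 2) * (1 - q ^ (2 * i + 1)))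
      (fun N ↦ if N = 0 then 1 else 0) := by
  intro N
  rcases N with _ | N
  · have h := invPoch_eq hq 0
    simp only [invPoch_zero, zero_add, pow_one] at h
    simp [invPoch_zero, ← h]
  have key : ∀ J ≤ N, (1 - q ^ (N + 1)) * ∑ i ∈ range (J + 1),
      (-1) ^ i * q ^ (i.choose 2) * (1 - q ^ (2 * i + 1)) *
        (invPoch q (N + 1 - i) * invPoch q (N + 1 + i + 1)) =
      (-1) ^ J * q ^ ((J + 1).choose 2) * (1 - q ^ (J + 1)) *
        (invPoch q (N - J) * invPoch q (N + 1 + J + 1)) := by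
    intro J
    induction J with
    | zero =>
      intro _
      simp [invPoch_eq hq N]
      ring
    | succ J ih =>
      intro hJ
      obtain ⟨d, rfl⟩ := Nat.exists_eq_add_of_le hJ
      rw [sum_range_succ, mul_add, ih (by omega)]
      have e1 : J + 1 + d - J = d + 1 := by omega
      have e2 : J + 1 + d + 1 - (J + 1) = d + 1 := by omega
      have e3 : J + 1 + d - (J + 1) = d := by omega
      rw [e1, e2, e3, invPoch_eq hq d, invPoch_eq hq (J + 1 + d + 1 + J + 1),
        Nat.choose_succ_succ' (J + 1) 1, Nat.choose_one_right,
        show J + 1 + d + 1 + (J + 1) + 1 = J + 1 + d + 1 + J + 1 + 1 by ring]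
      ring
  have h0 := one_sub_pow_succ_ne_zero hq N
  simp only [Nat.succ_ne_zero, if_false]
  symm
  apply mul_left_cancel₀ h0
  rw [sum_range_succ, mul_add, key N le_rfl]
  simp only [Nat.sub_self]
  have h1 := invPoch_eq hq 0
  simp only [invPoch_zero, zero_add, pow_one] at h1
  rw [invPoch_zero, invPoch_eq hq (N + 1 + N + 1),
    show N + 1 + (N + 1) + 1 = N + 1 + N + 1 + 1 by ring]
  ring

/-- Passing from a Bailey pair relative to `q` to one relative to `1`. -/
lemma IsBaileyPair.of_one {q : ℂ} (hq : ‖q‖ < 1) {A γ β : ℕ → ℂ}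
    (h : IsBaileyPair q 1 (fun i ↦ A i * (1 - q ^ (2 * i + 1))) β) (h0 : γ 0 = A 0)
    (hγ : ∀ i, γ (i + 1) = A (i + 1) - A i * q ^ (2 * i + 1)) :
    IsBaileyPair q 0 γ β := by
  intro N
  rw [h N, sum_range_succ' (fun i ↦ γ i * _), h0]
  simp only [hγ, sub_mul, sum_sub_distrib]
  have h1 : ∑ i ∈ range (N + 1), A i * (1 - q ^ (2 * i + 1)) *
      (invPoch q (N - i) * invPoch q (N + i + 1)) =
      ∑ i ∈ range (N + 1), A i * (invPoch q (N - i) * invPoch q (N + i)) -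
      ∑ i ∈ range N, A i * q ^ (2 * i + 1) *
        (invPoch q (N - (i + 1)) * invPoch q (N + (i + 1))) := by
    rw [sum_range_succ, sum_range_succ _ N, add_sub_right_comm, ← sum_sub_distrib]
    congr 1
    · refine sum_congr rfl fun i hi ↦ ?_
      obtain ⟨d, rfl⟩ := Nat.exists_eq_add_of_lt (mem_range.mp hi)
      have e1 : i + d + 1 - i = d + 1 := by omega
      have e2 : i + d + 1 - (i + 1) = d := by omega
      rw [e1, e2, invPoch_eq hq d, invPoch_eq hq (i + d + 1 + i), ← add_assoc]
      ring
    · rw [invPoch_eq hq (N + N)]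
      ring
  rw [h1, sum_range_succ']
  simp only [add_zero]
  ring

lemma tendsto_of_isBaileyPair {q : ℂ} (hq : ‖q‖ < 1) {e : ℕ} {γ β : ℕ → ℂ}
    (h : IsBaileyPair q e γ β) (hγ : Summable fun i ↦ ‖γ i‖) :
    Tendsto β atTop (𝓝 ((∑' i, γ i) * ((pochInf q q)⁻¹ * (pochInf q q)⁻¹))) := by
  obtain ⟨C, hC⟩ := exists_norm_invPoch_le hq
  have hC0 : 0 ≤ C := (norm_nonneg _).trans (hC 0)
  have hβ : β = fun N ↦ ∑' i, if i ∈ range (N + 1) then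
      γ i * (invPoch q (N - i) * invPoch q (N + i + e)) else 0 := by
    funext N
    rw [h N, tsum_eq_sum (s := range (N + 1)) (fun i hi ↦ if_neg hi)]
    exact sum_congr rfl fun i hi ↦ (if_pos hi).symm
  rw [hβ, ← tsum_mul_right]
  refine tendsto_tsum_of_dominated_convergence (bound := fun i ↦ ‖γ i‖ * (C * C))
    (hγ.mul_right _) (fun i ↦ ?_) (Eventually.of_forall fun N i ↦ ?_)
  · have h1 : Tendsto (fun N ↦ invPoch q (N - i)) atTop (𝓝 (pochInf q q)⁻¹) :=
      (tendsto_invPoch hq).comp (tendsto_sub_atTop_nat i)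
    have h2 : Tendsto (fun N ↦ invPoch q (N + i + e)) atTop (𝓝 (pochInf q q)⁻¹) := by
      simp only [add_assoc]
      exact (tendsto_invPoch hq).comp (tendsto_add_atTop_nat (i + e))
    refine ((h1.mul h2).const_mul (γ i)).congr' ?_
    filter_upwards [eventually_ge_atTop i] with N hN
    rw [if_pos (mem_range_succ_iff.mpr hN)]
  · split_ifs
    · rw [norm_mul, norm_mul]
      gcongr <;> exact hC _
    · rw [norm_zero]
      positivity

/-! ### The Jacobi triple product -/

/-- The `q`-binomial theorem in homogeneous form. -/
lemma prod_sub_mul_pow {q : ℂ} (hq : ‖q‖ < 1) (u v : ℂ) (n : ℕ) :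
    (∏ t ∈ range n, (u - v * q ^ t)) * invPoch q n =
      ∑ k ∈ range (n + 1), (-1) ^ k * q ^ (k.choose 2) * v ^ k * u ^ (n - k) *
        (invPoch q k * invPoch q (n - k)) := by
  induction n with
  | zero => simp [invPoch_zero]
  | succ n ih =>
    apply mul_left_cancel₀ (one_sub_pow_succ_ne_zero hq n)
    set F : ℕ → ℂ := fun k ↦ (-1) ^ k * q ^ (k.choose 2) * v ^ k * u ^ (n + 1 - k) *
        (invPoch q k * invPoch q (n + 1 - k))
    have hsplit : (1 - q ^ (n + 1)) * ∑ k ∈ range (n + 1 + 1), F k =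
        ∑ k ∈ range (n + 1 + 1), (1 - q ^ (n + 1 - k)) * F k +
        ∑ k ∈ range (n + 1 + 1), q ^ (n + 1 - k) * (1 - q ^ k) * F k := by
      rw [mul_sum, ← sum_add_distrib]
      refine sum_congr rfl fun k hk ↦ ?_
      have : q ^ (n + 1) = q ^ (n + 1 - k) * q ^ k := by
        rw [← pow_add, Nat.sub_add_cancel (by simpa using mem_range_succ_iff.mp hk)]
      rw [this]; ring
    have h1 : ∑ k ∈ range (n + 1 + 1), (1 - q ^ (n + 1 - k)) * F k =
        u * ((∏ t ∈ range n, (u - v * q ^ t)) * invPoch q n) := by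
      rw [sum_range_succ, ih, mul_sum]
      simp only [Nat.sub_self, pow_zero, sub_self, zero_mul, add_zero]
      refine sum_congr rfl fun k hk ↦ ?_
      have e : n + 1 - k = n - k + 1 := by have := mem_range_succ_iff.mp hk; omega
      simp only [F, e]
      rw [invPoch_eq hq (n - k)]; ring
    have h2 : ∑ k ∈ range (n + 1 + 1), q ^ (n + 1 - k) * (1 - q ^ k) * F k =
        -(v * q ^ n) * ((∏ t ∈ range n, (u - v * q ^ t)) * invPoch q n) := by
      rw [sum_range_succ', ih, mul_sum]
      simp only [pow_zero, sub_self, zero_mul, mul_zero, add_zero]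
      refine sum_congr rfl fun k hk ↦ ?_
      obtain ⟨d, rfl⟩ := Nat.exists_eq_add_of_le (mem_range_succ_iff.mp hk)
      have e : k + d + 1 - (k + 1) = d := by omega
      have e' : k + d - k = d := by omega
      simp only [F, e, e']
      rw [invPoch_eq hq k, Nat.choose_succ_succ' k 1, Nat.choose_one_right]
      ring
    rw [hsplit, h1, h2, prod_range_succ, invPoch_eq hq n]
    ring

/-- The coefficients of Ramanujan's theta function
`∑_{i ∈ ℤ} (-1)^i x^{i(i+1)/2} y^{i(i-1)/2}`, with the terms of index `i` and `-i` combined. -/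
noncomputable def thetaCoeff (x y : ℂ) (i : ℕ) : ℂ :=
  if i = 0 then 1 else (-1) ^ i * (x * y) ^ (i.choose 2) * (x ^ i + y ^ i)

lemma prod_sub_mul_pow_of_eq {x y : ℂ} (N : ℕ) :
    ∏ t ∈ range (2 * N), ((x * y) ^ N - x * (x * y) ^ t) =
      (-1) ^ N * x ^ N * (x * y) ^ (N.choose 2 + N * N) *
        (pochFin x (x * y) N * pochFin y (x * y) N) := by
  rw [two_mul, prod_range_add]
  have h1 : ∏ t ∈ range N, ((x * y) ^ N - x * (x * y) ^ t) =
      (-1) ^ N * x ^ N * (x * y) ^ (N.choose 2) * pochFin y (x * y) N := by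
    have : ∀ t ∈ range N, (x * y) ^ N - x * (x * y) ^ t =
        (-x) * (x * y) ^ t * (1 - y * (x * y) ^ (N - 1 - t)) := by
      intro t ht
      obtain ⟨d, rfl⟩ := Nat.exists_eq_add_of_lt (mem_range.mp ht)
      have e : t + d + 1 - 1 - t = d := by omega
      rw [e]; ring
    rw [prod_congr rfl this, prod_mul_distrib, prod_mul_distrib,
      prod_range_reflect (fun t ↦ 1 - y * (x * y) ^ t) N, prod_const, card_range,
      prod_pow_eq_pow_sum, sum_range_id, ← Nat.choose_two_right, neg_pow]
    rfl
  have h2 : ∏ t ∈ range N, ((x * y) ^ N - x * (x * y) ^ (N + t)) =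
      (x * y) ^ (N * N) * pochFin x (x * y) N := by
    have : ∀ t ∈ range N, (x * y) ^ N - x * (x * y) ^ (N + t) =
        (x * y) ^ N * (1 - x * (x * y) ^ t) := fun t _ ↦ by ring
    rw [prod_congr rfl this, prod_mul_distrib, prod_const, card_range, ← pow_mul]
    rfl
  rw [h1, h2]; ring

lemma choose_two_add (m n : ℕ) : (m + n).choose 2 = m.choose 2 + n.choose 2 + m * n := by
  induction n with
  | zero => simp
  | succ n ih =>
    rw [← add_assoc, Nat.choose_succ_succ' (m + n) 1, Nat.choose_succ_succ' n 1, ih]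
    simp only [Nat.choose_one_right]
    ring

lemma mul_self_eq_choose_two (n : ℕ) : n * n = 2 * n.choose 2 + n := by
  induction n with
  | zero => simp
  | succ n ih =>
    rw [Nat.choose_succ_succ' n 1, Nat.choose_one_right]
    linarith

/-- A finite form of the Jacobi triple product identity. -/
lemma isBaileyPair_thetaCoeff {x y : ℂ} (h : ‖x * y‖ < 1) (hx : x ≠ 0) (hy : y ≠ 0) :
    IsBaileyPair (x * y) 0 (thetaCoeff x y)
      (fun N ↦ pochFin x (x * y) N * pochFin y (x * y) N * invPoch (x * y) (2 * N)) := by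
  intro N
  set Q := x * y with hQ
  have hc : (-1) ^ N * x ^ N * Q ^ (N.choose 2 + N * N) ≠ 0 := by
    simp [hQ, hx, hy]
  apply mul_left_cancel₀ hc
  have hb := prod_sub_mul_pow h (Q ^ N) x (2 * N)
  rw [hQ, prod_sub_mul_pow_of_eq, ← hQ] at hb
  rw [← mul_assoc, hb, show 2 * N + 1 = N + (N + 1) by ring, sum_range_add,
    ← sum_range_reflect, sum_range_succ', sum_range_succ' (fun i ↦ thetaCoeff x y i * _),
    ← add_assoc, ← sum_add_distrib, mul_add, mul_sum]
  congr 1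
  · refine sum_congr rfl fun i hi ↦ ?_
    obtain ⟨d, rfl⟩ := Nat.exists_eq_add_of_lt (mem_range.mp hi)
    have e1 : i + d + 1 - 1 - i = d := by omega
    have e2 : 2 * (i + d + 1) - d = d + 2 * (i + 1) := by omega
    have e3 : 2 * (i + d + 1) - (i + d + 1 + (i + 1)) = d := by omega
    have e4 : i + d + 1 - (i + 1) = d := by omega
    rw [e1, e2, e3, e4, thetaCoeff, if_neg (Nat.succ_ne_zero i), ← hQ,
      show i + d + 1 = d + (i + 1) by ring, choose_two_add (d + (i + 1)) (i + 1),
      choose_two_add d (i + 1), show d + (i + 1) + (i + 1) + 0 = d + 2 * (i + 1) by ring,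
      show d + (i + 1) + (i + 1) = d + 2 * (i + 1) by ring]
    generalize hp : i + 1 = p
    have hs : ((-1 : ℂ)) ^ p * (-1) ^ p = 1 := by rw [← mul_pow]; simp
    have h2 := mul_self_eq_choose_two p
    have hT : Q ^ d.choose 2 * x ^ d * (Q ^ (d + p)) ^ (d + 2 * p) =
        x ^ (d + p) * Q ^ (d.choose 2 + p.choose 2 + d * p + (d + p) * (d + p)) *
          (Q ^ p.choose 2 * y ^ p) := by
      have e : d.choose 2 + (d + p) * (d + 2 * p) =
          d.choose 2 + p.choose 2 + d * p + (d + p) * (d + p) + p.choose 2 + p := by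
        linarith
      rw [← pow_mul, mul_right_comm, ← pow_add, e, pow_add _ _ p, hQ, mul_pow x y p]
      ring
    have hp1 : ((-1 : ℂ)) ^ (d + 2 * p) = (-1) ^ d := by
      rw [pow_add, two_mul, pow_add, hs, mul_one]
    have hp2 : ((-1 : ℂ)) ^ (d + p) * (-1) ^ p = (-1) ^ d := by
      rw [pow_add, mul_assoc, hs, mul_one]
    rw [hp1]
    linear_combination (-1) ^ d * (invPoch Q d * invPoch Q (d + 2 * p)) * hT -
      x ^ (d + p) * Q ^ (d.choose 2 + p.choose 2 + d * p + (d + p) * (d + p)) *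
        (Q ^ p.choose 2 * (x ^ p + y ^ p) * (invPoch Q d * invPoch Q (d + 2 * p))) * hp2
  · have e : 2 * N - N = N := by omega
    simp only [add_zero, e, Nat.sub_zero, thetaCoeff, if_true]
    ring


lemma summable_thetaCoeff {x y : ℂ} (hx : ‖x‖ < 1) (hy : ‖y‖ < 1) :
    Summable fun i ↦ ‖thetaCoeff x y i‖ := by
  have hs := (summable_geometric_of_lt_one (norm_nonneg x) hx).add
    (summable_geometric_of_lt_one (norm_nonneg y) hy)
  refine hs.of_nonneg_of_le (fun _ ↦ norm_nonneg _) fun i ↦ ?_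
  rw [thetaCoeff]
  split_ifs with hi
  · simp [hi]
  · have hxy : ‖(x * y) ^ i.choose 2‖ ≤ 1 := by
      rw [norm_pow, norm_mul]
      exact pow_le_one₀ (by positivity) (mul_le_one₀ hx.le (norm_nonneg y) hy.le)
    rw [norm_mul, norm_mul, norm_pow, norm_neg, norm_one, one_pow, one_mul]
    calc _ ≤ 1 * ‖x ^ i + y ^ i‖ := by gcongr
      _ ≤ ‖x‖ ^ i + ‖y‖ ^ i := by
        rw [one_mul, ← norm_pow, ← norm_pow]
        exact norm_add_le _ _

lemma pochInf_zero_right (z : ℂ) : pochInf z 0 = 1 - z := by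
  rw [pochInf, tprod_eq_mulSingle 0 fun j hj ↦ by simp [hj]]
  simp

/-- The Jacobi triple product identity. -/
lemma tsum_thetaCoeff {x y : ℂ} (hx : ‖x‖ < 1) (hy : ‖y‖ < 1) :
    ∑' i, thetaCoeff x y i =
      pochInf (x * y) (x * y) * pochInf y (x * y) * pochInf x (x * y) := by
  have h : ‖x * y‖ < 1 := by
    rw [norm_mul]
    exact mul_lt_one_of_nonneg_of_lt_one_left (norm_nonneg x) hx hy.le
  by_cases hxy : x * y = 0
  · rw [hxy]
    simp only [pochInf_zero_right]
    rw [tsum_eq_sum (s := range 2) fun i hi ↦ ?_]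
    · simp only [thetaCoeff, sum_range_succ, sum_range_zero, hxy]
      simp
      linear_combination -hxy
    · have hi2 : 2 ≤ i := not_lt.mp (mem_range.not.mp hi)
      rw [thetaCoeff, if_neg (by omega), hxy, zero_pow (Nat.choose_pos hi2).ne']
      simp
  obtain ⟨hx0, hy0⟩ := mul_ne_zero_iff.mp hxy
  have h1 := tendsto_of_isBaileyPair h (isBaileyPair_thetaCoeff h hx0 hy0)
    (summable_thetaCoeff hx hy)
  have h2 := ((tendsto_pochFin x h).mul (tendsto_pochFin y h)).mul
    ((tendsto_invPoch h).comp (tendsto_id.const_mul_atTop' (two_pos : 0 < 2)))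
  have h3 := tendsto_nhds_unique h1 h2
  have h0 := pochInf_self_ne_zero h
  field_simp at h3
  rw [h3]
  ring

/-! ### The iterated Bailey chain -/

/-- The result of applying the Bailey transformation `n` times, starting from `1 / (q; q)_N`, the
`j`-th outermost step (for `1 ≤ j ≤ n`) being relative to `q` if `a ≤ j`, and to `1` otherwise. -/
noncomputable def gordonBeta (q : ℂ) : ℕ → ℕ → ℕ → ℂ
  | 0, _ => invPoch q
  | n + 1, a => baileyStep q (if a ≤ 1 then 1 else 0) (gordonBeta q n (a - 1))

lemma isBaileyPair_gordonBeta_one {q : ℂ} (hq : ‖q‖ < 1) (m : ℕ) {a : ℕ} (ha : a ≤ 1) :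
    IsBaileyPair q 1 (fun i ↦ ((-1) ^ i * q ^ (i.choose 2 + (m + 1) * (i ^ 2 + i))) *
      (1 - q ^ (2 * i + 1))) (gordonBeta q m a) := by
  induction m generalizing a with
  | zero =>
    convert (isBaileyPair_unit hq).step hq using 1
    · funext i
      ring
    · funext N
      simp [gordonBeta, baileyStep]
  | succ m ih =>
    have h := (ih (a := a - 1) (by omega)).step hq
    rw [gordonBeta, if_pos ha]
    convert h using 1
    funext i
    ring

lemma isBaileyPair_gordonBeta {q : ℂ} (hq : ‖q‖ < 1) (m b : ℕ) :
    IsBaileyPair q 0 (thetaCoeff (q ^ (2 * m + b + 2)) (q ^ (b + 1)))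
      (gordonBeta q (m + b) (b + 1)) := by
  have key : IsBaileyPair q 0 (fun i ↦ q ^ (b * i ^ 2) * if i = 0 then 1 else
      (-1) ^ i * q ^ (i.choose 2 + (m + 1) * (i ^ 2 + i)) -
      (-1) ^ (i - 1) * q ^ ((i - 1).choose 2 + (m + 1) * ((i - 1) ^ 2 + (i - 1))) *
        q ^ (2 * (i - 1) + 1)) (gordonBeta q (m + b) (b + 1)) := by
    induction b with
    | zero =>
      refine (isBaileyPair_gordonBeta_one hq m le_rfl).of_one hq ?_ fun i ↦ ?_ <;> simp
    | succ b ih =>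
      have h := ih.step hq
      rw [← add_assoc, gordonBeta, if_neg (by omega), Nat.add_sub_cancel]
      convert h using 1
      funext i
      ring
  convert key using 1
  funext i
  rcases i with _ | i
  · simp [thetaCoeff]
  · have h2 := mul_self_eq_choose_two i
    rw [thetaCoeff, if_neg (Nat.succ_ne_zero i), if_neg (Nat.succ_ne_zero i), Nat.add_sub_cancel,
      Nat.choose_succ_succ' i 1, Nat.choose_one_right]
    generalize i.choose 2 = c at h2
    have e1 : b * (i + 1) ^ 2 + (i + c + (m + 1) * ((i + 1) ^ 2 + (i + 1))) =
        (2 * m + b + 2 + (b + 1)) * (i + c) + (2 * m + b + 2) * (i + 1) := by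
      linear_combination (b + m + 1) * h2
    have e2 : b * (i + 1) ^ 2 + (c + (m + 1) * (i ^ 2 + i) + (2 * i + 1)) =
        (2 * m + b + 2 + (b + 1)) * (i + c) + (b + 1) * (i + 1) := by
      linear_combination (b + m + 1) * h2
    have h1 := congrArg (q ^ ·) e1
    have h2 := congrArg (q ^ ·) e2
    beta_reduce at h1 h2
    linear_combination (-1) ^ i * h2 - (-1) ^ (i + 1) * h1

/-! ### The multiple sum -/

/-- The exponent of `q` in the multiple sum over `f : Fin n → ℕ`. -/
def gordonExp (n a : ℕ) (f : Fin n → ℕ) : ℕ :=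
  ∑ j ∈ range n, ((partialSumN (n + 1) f (j + 1)) ^ 2 +
    if a ≤ j + 1 then partialSumN (n + 1) f (j + 1) else 0)

/-- The summand of the multiple sum over `f : Fin n → ℕ`. -/
noncomputable def gordonTerm (q : ℂ) (n a : ℕ) (f : Fin n → ℕ) : ℂ :=
  q ^ gordonExp n a f * ∏ i, invPoch q (f i)

lemma partialSumN_one (n : ℕ) (f : Fin n → ℕ) : partialSumN (n + 1) f 1 = ∑ i, f i := by
  simp [partialSumN]

lemma gordonExp_cons (n a x : ℕ) (f : Fin n → ℕ) :
    gordonExp (n + 1) a (Fin.cons x f : Fin (n + 1) → ℕ) = gordonExp n (a - 1) f +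
      ((x + ∑ i, f i) ^ 2 + (if a ≤ 1 then 1 else 0) * (x + ∑ i, f i)) := by
  rw [gordonExp, sum_range_succ', zero_add, partialSumN_one, Fin.sum_cons, gordonExp]
  congr 1
  · refine sum_congr rfl fun j _ ↦ ?_
    have : partialSumN (n + 1 + 1) (Fin.cons x f : Fin (n + 1) → ℕ) (j + 1 + 1) =
        partialSumN (n + 1) f (j + 1) := by
      simp only [partialSumN]
      refine (Fin.sum_univ_succ (n := n) _).trans ?_
      simp
    rw [this]
    simp only [Nat.sub_le_iff_le_add]
  · split_ifs <;> simp

lemma sum_le_gordonExp (n a : ℕ) (f : Fin n → ℕ) : ∑ i, f i ≤ gordonExp n a f := by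
  rcases n with _ | n
  · simp
  · rw [gordonExp, sum_range_succ', zero_add, partialSumN_one]
    exact (Nat.le_self_pow two_ne_zero _).trans
      ((Nat.le_add_right _ _).trans (Nat.le_add_left _ _))

lemma summable_pow_sum {x : ℝ} (h0 : 0 ≤ x) (h1 : x < 1) (n : ℕ) :
    Summable fun f : Fin n → ℕ ↦ x ^ ∑ i, f i := by
  induction n with
  | zero => exact Summable.of_finite
  | succ n ih =>
    rw [← (Fin.consEquiv fun _ ↦ ℕ).summable_iff]
    refine ((summable_geometric_of_lt_one h0 h1).mul_of_nonneg ih (fun _ ↦ by positivity)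
      fun _ ↦ by positivity).congr fun p ↦ ?_
    simp [Fin.consEquiv, Fin.sum_cons, pow_add]

lemma summable_gordonTerm {q : ℂ} (hq : ‖q‖ < 1) (n a : ℕ) :
    Summable fun f ↦ ‖gordonTerm q n a f‖ := by
  obtain ⟨C, hC⟩ := exists_norm_invPoch_le hq
  refine ((summable_pow_sum (norm_nonneg q) hq n).mul_right (C ^ n)).of_nonneg_of_le
    (fun _ ↦ norm_nonneg _) fun f ↦ ?_
  rw [gordonTerm, norm_mul, norm_pow, norm_prod]
  gcongr ?_ * ?_
  · exact pow_le_pow_of_le_one (norm_nonneg q) hq.le (sum_le_gordonExp n a f)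
  · calc _ ≤ ∏ _i : Fin n, C := prod_le_prod (fun _ _ ↦ norm_nonneg _) fun i _ ↦ hC _
      _ = C ^ n := by simp

/-- `1 / (q; q)_{N-s}`, interpreted as `0` if `N < s`. -/
noncomputable def invPochSub (q : ℂ) (N s : ℕ) : ℂ := if s ≤ N then invPoch q (N - s) else 0

lemma finite_support_invPochSub (q : ℂ) (n N : ℕ) (g : (Fin n → ℕ) → ℂ) :
    (Function.support fun f : Fin n → ℕ ↦ invPochSub q N (∑ i, f i) * g f).Finite := by
  refine (Set.finite_Iic fun _ : Fin n ↦ N).subset fun f hf i ↦ ?_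
  by_contra hi
  apply hf
  have : ¬ ∑ i, f i ≤ N := fun h ↦
    hi ((single_le_sum (fun _ _ ↦ Nat.zero_le _) (mem_univ i)).trans h)
  simp [invPochSub, this]

lemma hasSum_gordonTerm (q : ℂ) (n a N : ℕ) :
    HasSum (fun f ↦ invPochSub q N (∑ i, f i) * gordonTerm q n a f) (gordonBeta q n a N) := by
  induction n generalizing a N with
  | zero =>
    convert hasSum_fintype (β := Fin 0 → ℕ) _ using 1
    simp [gordonBeta, gordonTerm, gordonExp, invPochSub]
  | succ n ih =>
    set e := if a ≤ 1 then 1 else 0 with he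
    set F : (Fin (n + 1) → ℕ) → ℂ :=
      fun f ↦ invPochSub q N (∑ i, f i) * gordonTerm q (n + 1) a f with hF
    have hs : Summable F := summable_of_hasFiniteSupport (finite_support_invPochSub q (n + 1) N _)
    let E : (Fin n → ℕ) × ℕ ≃ (Fin (n + 1) → ℕ) :=
      (Equiv.prodComm _ _).trans (Fin.consEquiv fun _ ↦ ℕ)
    have hFE : ∀ f x, F (E (f, x)) = invPochSub q N (x + ∑ i, f i) *
        (q ^ ((x + ∑ i, f i) ^ 2 + e * (x + ∑ i, f i)) * invPoch q x) *
          gordonTerm q n (a - 1) f := by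
      intro f x
      have hE : E (f, x) = Fin.cons x f := rfl
      rw [hE, hF]
      simp only [gordonTerm, gordonExp_cons, Fin.sum_cons, Fin.prod_univ_succ, Fin.cons_zero,
        Fin.cons_succ, ← he]
      ring
    have hfib : ∀ f, HasSum (fun x ↦ F (E (f, x))) (∑ s ∈ range (N + 1),
        q ^ (s ^ 2 + e * s) * invPoch q (N - s) *
          (invPochSub q s (∑ i, f i) * gordonTerm q n (a - 1) f)) := by
      intro f
      set h : ℕ → ℂ := fun s ↦ invPochSub q N s * (q ^ (s ^ 2 + e * s) *
        invPochSub q s (∑ i, f i)) * gordonTerm q n (a - 1) f with hh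
      have h1 : (fun x ↦ F (E (f, x))) = h ∘ (· + ∑ i, f i) := by
        funext x
        simp [hFE, hh, invPochSub]
      have h2 : ∑ s ∈ range (N + 1), q ^ (s ^ 2 + e * s) * invPoch q (N - s) *
          (invPochSub q s (∑ i, f i) * gordonTerm q n (a - 1) f) =
          ∑ s ∈ range (N + 1), h s := by
        refine sum_congr rfl fun s hs ↦ ?_
        rw [hh]
        simp only [invPochSub, if_pos (mem_range_succ_iff.mp hs)]
        ring
      rw [h1, h2, (add_left_injective _).hasSum_iff]
      · refine hasSum_sum_of_ne_finset_zero fun s hs ↦ ?_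
        have : ¬ s ≤ N := by simpa using hs
        simp [hh, invPochSub, this]
      · intro s hs
        have : ¬ ∑ i, f i ≤ s := fun hle ↦ hs ⟨s - ∑ i, f i, Nat.sub_add_cancel hle⟩
        simp [hh, invPochSub, this]
    have h3 := (E.hasSum_iff.mpr hs.hasSum).prod_fiberwise hfib
    have h4 : HasSum (fun f ↦ ∑ s ∈ range (N + 1), q ^ (s ^ 2 + e * s) * invPoch q (N - s) *
        (invPochSub q s (∑ i, f i) * gordonTerm q n (a - 1) f)) (gordonBeta q (n + 1) a N) :=
      hasSum_sum fun s _ ↦ (ih (a - 1) s).mul_left _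
    rw [h4.unique h3]
    exact hs.hasSum

lemma tendsto_gordonBeta {q : ℂ} (hq : ‖q‖ < 1) (n a : ℕ) :
    Tendsto (gordonBeta q n a) atTop
      (𝓝 ((pochInf q q)⁻¹ * ∑' f, gordonTerm q n a f)) := by
  obtain ⟨C, hC⟩ := exists_norm_invPoch_le hq
  rw [← tsum_mul_left, funext fun N ↦ ((hasSum_gordonTerm q n a N).tsum_eq).symm]
  refine tendsto_tsum_of_dominated_convergence (bound := fun f ↦ C * ‖gordonTerm q n a f‖)
    ((summable_gordonTerm hq n a).mul_left C) (fun f ↦ ?_)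
    (Eventually.of_forall fun N f ↦ ?_)
  · refine Tendsto.mul_const _ ?_
    refine ((tendsto_invPoch hq).comp (tendsto_sub_atTop_nat (∑ i, f i))).congr' ?_
    filter_upwards [eventually_ge_atTop (∑ i, f i)] with N hN
    exact (if_pos hN).symm
  · rw [norm_mul, invPochSub]
    gcongr
    split_ifs
    · exact hC _
    · rw [norm_zero]
      exact (norm_nonneg _).trans (hC 0)

lemma tsum_gordonTerm {q : ℂ} (hq : ‖q‖ < 1) (m b : ℕ) :
    ∑' f, gordonTerm q (m + b) (b + 1) f =
      pochInf (q ^ (2 * (m + b + 1) + 1)) (q ^ (2 * (m + b + 1) + 1)) *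
        pochInf (q ^ (b + 1)) (q ^ (2 * (m + b + 1) + 1)) *
        pochInf (q ^ (2 * m + b + 2)) (q ^ (2 * (m + b + 1) + 1)) / pochInf q q := by
  have hpow (l : ℕ) : ‖q ^ (l + 1)‖ < 1 := by
    rw [norm_pow]
    exact pow_lt_one₀ (norm_nonneg q) hq (Nat.succ_ne_zero l)
  have hx := hpow (2 * m + b + 1)
  have hy := hpow b
  have h := tendsto_nhds_unique (tendsto_gordonBeta hq (m + b) (b + 1))
    (tendsto_of_isBaileyPair hq (isBaileyPair_gordonBeta hq m b) (summable_thetaCoeff hx hy))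
  have h0 := pochInf_self_ne_zero hq
  rw [tsum_thetaCoeff hx hy, ← pow_add,
    show 2 * m + b + 2 + (b + 1) = 2 * (m + b + 1) + 1 by ring] at h
  field_simp at h
  rw [eq_div_iff h0, mul_comm, h]

lemma gordonExp_eq (n a : ℕ) (ha : 1 ≤ a) (f : Fin n → ℕ) :
    gordonExp n a f = (∑ j ∈ Icc 1 n, (partialSumN (n + 1) f j) ^ 2) +
      ∑ j ∈ Icc a n, partialSumN (n + 1) f j := by
  have h : Icc a n = (Icc 1 n).filter (a ≤ ·) := by
    ext j
    simp only [mem_Icc, mem_filter]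
    omega
  rw [h, sum_filter, ← sum_add_distrib, ← Ico_add_one_right_eq_Icc, sum_Ico_eq_sum_range,
    gordonExp, Nat.add_sub_cancel]
  simp only [add_comm 1]

/-- Andrews' analytic form of the Rogers–Ramanujan–Gordon identity:
`Σ_{n_1,…,n_{k-1}≥0} q^{N_1²+⋯+N_{k-1}² + N_a+⋯+N_{k-1}} / ((q;q)_{n_1}⋯(q;q)_{n_{k-1}})`
equals `(q^{2k+1}; q^{2k+1})_∞ (q^a; q^{2k+1})_∞ (q^{2k+1-a}; q^{2k+1})_∞ / (q; q)_∞`. -/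
theorem andrews_analytic (k a : ℕ) (hk : 2 ≤ k) (ha : 1 ≤ a) (hak : a ≤ k)
    (q : ℂ) (hq : ‖q‖ < 1) :
    ∑' f : Fin (k - 1) → ℕ,
      q ^ ((∑ j ∈ Finset.Icc 1 (k - 1), (partialSumN k f j) ^ 2) +
            ∑ j ∈ Finset.Icc a (k - 1), partialSumN k f j) /
        ∏ i : Fin (k - 1), pochFin q q (f i) =
      pochInf (q ^ (2 * k + 1)) (q ^ (2 * k + 1)) * pochInf (q ^ a) (q ^ (2 * k + 1)) *
        pochInf (q ^ (2 * k + 1 - a)) (q ^ (2 * k + 1)) / pochInf q q := by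
  obtain ⟨b, rfl⟩ := Nat.exists_eq_add_of_le' ha
  obtain ⟨m, rfl⟩ := Nat.exists_eq_add_of_le' hak
  have e : 2 * (m + (b + 1)) + 1 - (b + 1) = 2 * m + b + 2 := by omega
  rw [e]
  refine Eq.trans (tsum_congr fun f ↦ ?_) (tsum_gordonTerm hq m b)
  refine Eq.trans ?_ (congrArg (q ^ · * ∏ i, invPoch q (f i))
    (gordonExp_eq (m + b) (b + 1) ha f)).symm
  simp only [invPoch, prod_inv_distrib, ← div_eq_mul_inv]
  rfl
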